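/- arXiv:1609.08172 — 3 statements merged into one kernel-verified Lean document; each statement's English description precedes it below -/
import Mathlib

section
/- Let n ≥ 1 and let U be an element of the n-qubit Clifford group C_n with tr(U) ≠ 0. Define Fix(U) := {a ∈ 𝔽₂^{2n} : U·W_a·U^† = W_a or U·W_a·U^† = −W_a}. Then there exists m ∈ ℕ such that |Fix(U)| = 2^m and (tr U)^4 = (−4)^m. -/
open scoped BigOperators

noncomputable section

/-- `t`-fold tensor (Kronecker) power of a matrix, acting on `(ℂ^α)^{⊗t}`. -/
def tpow {α : Type*} [Fintype α] (M : Matrix α α ℂ) (t : ℕ) :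
    Matrix (Fin t → α) (Fin t → α) ℂ :=
  Matrix.of fun x y => ∏ i, M (x i) (y i)

/-- The rank-one operator `|ψ⟩⟨ψ|`. -/
def rankOne {α : Type*} (ψ : α → ℂ) : Matrix α α ℂ :=
  Matrix.of fun i j => ψ i * (starRingEnd ℂ) (ψ j)

/-- The operator `U_σ` permuting the `t` tensor factors of `(ℂ^α)^{⊗t}`. -/
def permOp (α : Type*) [DecidableEq α] {t : ℕ} (σ : Equiv.Perm (Fin t)) :
    Matrix (Fin t → α) (Fin t → α) ℂ :=
  Matrix.of fun x y => if (fun k => x (σ k)) = y then 1 else 0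

/-- The projector `P_[t]` onto the symmetric subspace `Sym_t(ℂ^α)`. -/
def symProj (α : Type*) [DecidableEq α] (t : ℕ) :
    Matrix (Fin t → α) (Fin t → α) ℂ :=
  (t.factorial : ℂ)⁻¹ • ∑ σ : Equiv.Perm (Fin t), permOp α σ

/-- Single-qubit Pauli matrices labelled by `𝔽₂²`:
`σ_{(0,0)} = I`, `σ_{(0,1)} = X`, `σ_{(1,0)} = Z`, `σ_{(1,1)} = Y`. -/
def pauli (a : ZMod 2 × ZMod 2) : Matrix (ZMod 2) (ZMod 2) ℂ :=
  Matrix.of fun x y =>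
    if a = (0, 0) then (if x = y then 1 else 0)
    else if a = (0, 1) then (if x = y + 1 then 1 else 0)
    else if a = (1, 0) then (if x = y then (if x = 0 then 1 else -1) else 0)
    else (if x = y + 1 then (if x = 0 then -Complex.I else Complex.I) else 0)

/-- The Pauli operator `W_a`, `a ∈ 𝔽₂^{2n}`, on qubits labelled by a finite type `Q`. -/
def PauliW {Q : Type*} [Fintype Q] (a : Q → ZMod 2 × ZMod 2) :
    Matrix (Q → ZMod 2) (Q → ZMod 2) ℂ :=
  Matrix.of fun x y => ∏ i, pauli (a i) (x i) (y i)

/-- The stabilizer projector `P_{n,k} = 2^{-2n}·Σ_{a∈𝔽₂^{2n}} W_a^{⊗k}`. -/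
def stabProj (n k : ℕ) :
    Matrix (Fin k → (Fin n → ZMod 2)) (Fin k → (Fin n → ZMod 2)) ℂ :=
  ((2 : ℂ) ^ (2 * n))⁻¹ • ∑ a : Fin n → ZMod 2 × ZMod 2, tpow (PauliW a) k

/-- A single-qubit gate `G` applied to qubit `i` of `n` qubits (identity elsewhere). -/
def embedGate (n : ℕ) (G : Matrix (ZMod 2) (ZMod 2) ℂ) (i : Fin n) :
    Matrix (Fin n → ZMod 2) (Fin n → ZMod 2) ℂ :=
  Matrix.of fun x y =>
    G (x i) (y i) * ∏ k ∈ Finset.univ.erase i, (if x k = y k then (1 : ℂ) else 0)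

/-- The Hadamard gate `((1+i)/2)·[[1,1],[1,−1]]`. -/
def hGate : Matrix (ZMod 2) (ZMod 2) ℂ :=
  Matrix.of fun x y => (1 + Complex.I) / 2 * (if x = 1 ∧ y = 1 then -1 else 1)

/-- The phase gate `diag(1, −i)`. -/
def sGate : Matrix (ZMod 2) (ZMod 2) ℂ :=
  Matrix.of fun x y => if x = y then (if x = 0 then 1 else -Complex.I) else 0

/-- The CNOT gate with control qubit `i` and target qubit `j`. -/
def cnotGate (n : ℕ) (i j : Fin n) :
    Matrix (Fin n → ZMod 2) (Fin n → ZMod 2) ℂ :=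
  Matrix.of fun x y =>
    if x i = y i ∧ x j = y i + y j ∧ ∀ k, k ≠ i → k ≠ j → x k = y k then 1 else 0

/-- Generators of the `n`-qubit Clifford group: Hadamard and phase gates on each qubit,
CNOT gates on each ordered pair of distinct qubits. -/
def cliffordGens (n : ℕ) : Set (Matrix (Fin n → ZMod 2) (Fin n → ZMod 2) ℂ) :=
  (⋃ i : Fin n, {embedGate n hGate i}) ∪ (⋃ i : Fin n, {embedGate n sGate i}) ∪
    ⋃ (i : Fin n) (j : Fin n) (_ : i ≠ j), {cnotGate n i j}

/-- The `n`-qubit Clifford group: the subgroup of the unitary group `U(2^n)` generated by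
the Hadamard and phase gates on each qubit together with the CNOT gates. -/
def CliffordGroup (n : ℕ) : Subgroup (Matrix.unitaryGroup (Fin n → ZMod 2) ℂ) :=
  Subgroup.closure
    {U : Matrix.unitaryGroup (Fin n → ZMod 2) ℂ |
      (U : Matrix (Fin n → ZMod 2) (Fin n → ZMod 2) ℂ) ∈ cliffordGens n}

/-! ### Single-qubit identities -/

/-- The Pauli matrices with Gaussian integer entries. -/
def pauliGaussian (a : ZMod 2 × ZMod 2) (x y : ZMod 2) : GaussianInt :=
  if a = (0, 0) then (if x = y then 1 else 0)
  else if a = (0, 1) then (if x = y + 1 then 1 else 0)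
  else if a = (1, 0) then (if x = y then (if x = 0 then 1 else -1) else 0)
  else (if x = y + 1 then (if x = 0 then ⟨0, -1⟩ else ⟨0, 1⟩) else 0)

theorem toComplex_pauliGaussian (a : ZMod 2 × ZMod 2) (x y : ZMod 2) :
    (pauliGaussian a x y).toComplex = pauli a x y := by
  simp only [pauliGaussian, pauli, Matrix.of_apply]
  split_ifs <;> simp [GaussianInt.toComplex_def]

theorem sum_pauli_mul_pauli (x y u v : ZMod 2) :
    ∑ a, pauli a x y * pauli a u v = if x = v ∧ y = u then 2 else 0 := by
  have h : ∀ x y u v : ZMod 2, ∑ a, pauliGaussian a x y * pauliGaussian a u v =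
      if x = v ∧ y = u then 2 else 0 := by decide
  have := congrArg GaussianInt.toComplex (h x y u v)
  simp only [map_sum, map_mul, toComplex_pauliGaussian] at this
  rw [this]
  split_ifs
  · exact map_ofNat _ 2
  · exact map_zero _

theorem sum_pauli_mul_pauli_swap (a b : ZMod 2 × ZMod 2) :
    ∑ x, ∑ y, pauli a x y * pauli b y x = if a = b then 2 else 0 := by
  have h : ∀ a b : ZMod 2 × ZMod 2, ∑ x, ∑ y, pauliGaussian a x y * pauliGaussian b y x =
      if a = b then 2 else 0 := by decide
  have := congrArg GaussianInt.toComplex (h a b)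
  simp only [map_sum, map_mul, toComplex_pauliGaussian] at this
  rw [this]
  split_ifs
  · exact map_ofNat _ 2
  · exact map_zero _

theorem exists_pauli_mul_pauli (a b : ZMod 2 × ZMod 2) :
    ∃ c : ℂ, c ≠ 0 ∧ pauli a * pauli b = c • pauli (a + b) := by
  have h : ∀ a b : ZMod 2 × ZMod 2,
      ∃ c ∈ ({⟨1, 0⟩, ⟨0, 1⟩, ⟨0, -1⟩} : Finset GaussianInt),
      ∀ x y, ∑ z, pauliGaussian a x z * pauliGaussian b z y = c * pauliGaussian (a + b) x y := by
    decide
  obtain ⟨c, hc, h⟩ := h a b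
  refine ⟨c.toComplex, ?_, ?_⟩
  · rw [Ne, GaussianInt.toComplex_eq_zero]
    rintro rfl
    revert hc
    decide
  · ext x y
    have := congrArg GaussianInt.toComplex (h x y)
    simpa only [map_sum, map_mul, toComplex_pauliGaussian, Matrix.mul_apply, Matrix.smul_apply,
      smul_eq_mul] using this

theorem exists_cnot_pauli (a b : ZMod 2 × ZMod 2) :
    ∃ a' b' : ZMod 2 × ZMod 2, ∃ s : ℂ, (s = 1 ∨ s = -1) ∧ ∀ x y u v : ZMod 2,
      pauli a x y * pauli b (u + x) (v + y) = s * (pauli a' x y * pauli b' u v) := by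
  have h : ∀ a b : ZMod 2 × ZMod 2, ∃ s ∈ ({1, -1} : Finset GaussianInt), ∀ x y u v : ZMod 2,
      pauliGaussian a x y * pauliGaussian b (u + x) (v + y) =
        s * (pauliGaussian (a.1 + b.1, a.2) x y * pauliGaussian (b.1, b.2 + a.2) u v) := by
    decide
  obtain ⟨s, hs, h⟩ := h a b
  refine ⟨(a.1 + b.1, a.2), (b.1, b.2 + a.2), s.toComplex, ?_, fun x y u v ↦ ?_⟩
  · simp only [Finset.mem_insert, Finset.mem_singleton] at hs
    rcases hs with rfl | rfl <;> simp
  · simpa only [map_mul, toComplex_pauliGaussian] using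
      congrArg GaussianInt.toComplex (h x y u v)

theorem exists_conj_pauli_of_gaussian {G : Matrix (ZMod 2) (ZMod 2) ℂ}
    {g : ZMod 2 → ZMod 2 → GaussianInt} {c : ℂ} {k : GaussianInt}
    (hc : c * star c * k.toComplex = 1) (hG : ∀ x y, G x y = c * (g x y).toComplex)
    (h : ∀ a : ZMod 2 × ZMod 2, ∃ b : ZMod 2 × ZMod 2, ∃ s ∈ ({1, -1} : Finset GaussianInt),
      ∀ x y, ∑ z, (∑ w, g x w * pauliGaussian a w z) * star (g y z) =
        k * (s * pauliGaussian b x y))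
    (a : ZMod 2 × ZMod 2) :
    ∃ (b : ZMod 2 × ZMod 2) (s : ℂ), (s = 1 ∨ s = -1) ∧
      G * pauli a * G.conjTranspose = s • pauli b := by
  obtain ⟨b, s, hs, h⟩ := h a
  refine ⟨b, s.toComplex, ?_, ?_⟩
  · simp only [Finset.mem_insert, Finset.mem_singleton] at hs
    rcases hs with rfl | rfl <;> simp
  ext x y
  have h := congrArg GaussianInt.toComplex (h x y)
  have hstar (z : GaussianInt) : (star z).toComplex = star z.toComplex :=
    GaussianInt.toComplex_star z
  simp only [map_sum, map_mul, toComplex_pauliGaussian, hstar] at h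
  have hL : (G * pauli a * G.conjTranspose) x y = c * star c *
      ∑ z, (∑ w, (g x w).toComplex * pauli a w z) * star (g y z).toComplex := by
    simp only [Matrix.mul_apply, Matrix.conjTranspose_apply, hG, star_mul', Finset.mul_sum,
      Finset.sum_mul]
    exact Finset.sum_congr rfl fun z _ => Finset.sum_congr rfl fun w _ => by ring
  rw [hL, Matrix.smul_apply, smul_eq_mul]
  rw [h, ← mul_assoc, hc, one_mul]

theorem exists_hGate_conj_pauli (a : ZMod 2 × ZMod 2) :
    ∃ (b : ZMod 2 × ZMod 2) (s : ℂ), (s = 1 ∨ s = -1) ∧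
      hGate * pauli a * hGate.conjTranspose = s • pauli b := by
  refine exists_conj_pauli_of_gaussian (g := fun x y => if x = 1 ∧ y = 1 then -1 else 1)
    (c := (1 + Complex.I) / 2) (k := 2) ?_ (fun x y => ?_) (by decide) a
  · have hI : Complex.I ^ 2 = -1 := Complex.I_sq
    simp only [star_div₀, star_add, star_one, star_ofNat, Complex.star_def, Complex.conj_I,
      map_ofNat]
    linear_combination (-1 / 2 : ℂ) * hI
  · simp only [hGate, Matrix.of_apply]
    split_ifs <;> simp

theorem exists_sGate_conj_pauli (a : ZMod 2 × ZMod 2) :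
    ∃ (b : ZMod 2 × ZMod 2) (s : ℂ), (s = 1 ∨ s = -1) ∧
      sGate * pauli a * sGate.conjTranspose = s • pauli b := by
  refine exists_conj_pauli_of_gaussian
    (g := fun x y => if x = y then (if x = 0 then 1 else ⟨0, -1⟩) else 0)
    (c := 1) (k := 1) (by simp) (fun x y => ?_) (by decide) a
  simp only [sGate, Matrix.of_apply]
  split_ifs <;> simp [GaussianInt.toComplex_def]

/-! ### Tensor products of single-qubit operators -/

section Tensor

variable {Q : Type*} [Fintype Q]

/-- The tensor product of a family of single-qubit operators. -/
def tensorOp (M : Q → Matrix (ZMod 2) (ZMod 2) ℂ) : Matrix (Q → ZMod 2) (Q → ZMod 2) ℂ :=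
  Matrix.of fun x y => ∏ i, M i (x i) (y i)

theorem PauliW_eq_tensorOp (a : Q → ZMod 2 × ZMod 2) :
    PauliW a = tensorOp fun i => pauli (a i) := rfl

theorem tensorOp_mul [DecidableEq Q] (M N : Q → Matrix (ZMod 2) (ZMod 2) ℂ) :
    tensorOp M * tensorOp N = tensorOp fun i => M i * N i := by
  ext x y
  simp only [tensorOp, Matrix.mul_apply, Matrix.of_apply, ← Finset.prod_mul_distrib]
  rw [Finset.prod_univ_sum, Fintype.piFinset_univ]

theorem tensorOp_conjTranspose (M : Q → Matrix (ZMod 2) (ZMod 2) ℂ) :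
    (tensorOp M).conjTranspose = tensorOp fun i => (M i).conjTranspose := by
  ext x y
  simp [tensorOp, Matrix.conjTranspose_apply]

theorem tensorOp_smul (c : Q → ℂ) (M : Q → Matrix (ZMod 2) (ZMod 2) ℂ) :
    tensorOp (fun i => c i • M i) = (∏ i, c i) • tensorOp M := by
  ext x y
  simp [tensorOp, Finset.prod_mul_distrib]

theorem embedGate_eq_tensorOp (n : ℕ) (G : Matrix (ZMod 2) (ZMod 2) ℂ) (i : Fin n) :
    embedGate n G i = tensorOp fun k => if k = i then G else 1 := by
  ext x y
  simp only [embedGate, tensorOp, Matrix.of_apply]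
  rw [← Finset.mul_prod_erase _ _ (Finset.mem_univ i)]
  congr 1
  · simp
  · refine Finset.prod_congr rfl fun k hk => ?_
    simp [Finset.ne_of_mem_erase hk, Matrix.one_apply]

theorem exists_PauliW_mul_PauliW [DecidableEq Q] (a b : Q → ZMod 2 × ZMod 2) :
    ∃ c : ℂ, c ≠ 0 ∧ PauliW a * PauliW b = c • PauliW (a + b) := by
  choose c hc h using fun i => exists_pauli_mul_pauli (a i) (b i)
  refine ⟨∏ i, c i, Finset.prod_ne_zero_iff.mpr fun i _ => hc i, ?_⟩
  rw [PauliW_eq_tensorOp, PauliW_eq_tensorOp, tensorOp_mul, funext h, tensorOp_smul]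
  rfl

theorem trace_PauliW_mul_PauliW [DecidableEq Q] (a b : Q → ZMod 2 × ZMod 2) :
    (PauliW a * PauliW b).trace = if a = b then 2 ^ Fintype.card Q else 0 := by
  have h : (PauliW a * PauliW b).trace =
      ∏ i, ∑ x, ∑ y, pauli (a i) x y * pauli (b i) y x := by
    rw [PauliW_eq_tensorOp, PauliW_eq_tensorOp, tensorOp_mul, Matrix.trace,
      Finset.prod_univ_sum, Fintype.piFinset_univ]
    rfl
  rw [h]
  simp only [sum_pauli_mul_pauli_swap]
  split_ifs with hab
  · simp [hab]
  · obtain ⟨i, hi⟩ := Function.ne_iff.mp hab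
    exact Finset.prod_eq_zero (Finset.mem_univ i) (if_neg hi)

theorem sum_PauliW_mul_PauliW [DecidableEq Q] (x y u v : Q → ZMod 2) :
    ∑ a : Q → ZMod 2 × ZMod 2, PauliW a x y * PauliW a u v =
      if x = v ∧ y = u then 2 ^ Fintype.card Q else 0 := by
  have h : ∑ a : Q → ZMod 2 × ZMod 2, PauliW a x y * PauliW a u v =
      ∏ i, ∑ b, pauli b (x i) (y i) * pauli b (u i) (v i) := by
    rw [Finset.prod_univ_sum, Fintype.piFinset_univ]
    simp only [PauliW, Matrix.of_apply, Finset.prod_mul_distrib]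
  rw [h]
  simp only [sum_pauli_mul_pauli]
  split_ifs with hxy
  · simp [hxy.1, hxy.2]
  · obtain ⟨i, hi⟩ : ∃ i, ¬(x i = v i ∧ y i = u i) := by
      by_contra! hall
      exact hxy ⟨funext fun i => (hall i).1, funext fun i => (hall i).2⟩
    exact Finset.prod_eq_zero (Finset.mem_univ i) (if_neg hi)

theorem sum_trace_PauliW_conj [DecidableEq Q] (A B : Matrix (Q → ZMod 2) (Q → ZMod 2) ℂ) :
    ∑ a : Q → ZMod 2 × ZMod 2, (PauliW a * (A * PauliW a * B)).trace =
      2 ^ Fintype.card Q * (A.trace * B.trace) := by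
  have h (a : Q → ZMod 2 × ZMod 2) : (PauliW a * (A * PauliW a * B)).trace =
      ∑ x, ∑ y, ∑ v, ∑ u, A y u * B v x * (PauliW a x y * PauliW a u v) := by
    simp only [Matrix.trace, Matrix.diag, Matrix.mul_apply, Finset.mul_sum, Finset.sum_mul]
    refine Finset.sum_congr rfl fun x _ => Finset.sum_congr rfl fun y _ =>
      Finset.sum_congr rfl fun v _ => Finset.sum_congr rfl fun u _ => by ring
  simp only [h]
  rw [Finset.sum_comm]
  have h' (x : Q → ZMod 2) : ∑ a : Q → ZMod 2 × ZMod 2, ∑ y, ∑ v, ∑ u,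
      A y u * B v x * (PauliW a x y * PauliW a u v) =
      ∑ y, A y y * B x x * 2 ^ Fintype.card Q := by
    rw [Finset.sum_comm]
    refine Finset.sum_congr rfl fun y _ => ?_
    rw [Finset.sum_comm]
    rw [Finset.sum_eq_single x, Finset.sum_comm, Finset.sum_eq_single y]
    · rw [← Finset.mul_sum, sum_PauliW_mul_PauliW, if_pos ⟨rfl, rfl⟩]
    · intro u _ hu
      rw [← Finset.mul_sum, sum_PauliW_mul_PauliW, if_neg fun h => hu h.2.symm, mul_zero]
    · simp
    · intro v _ hv
      rw [Finset.sum_comm]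
      refine Finset.sum_eq_zero fun u _ => ?_
      rw [← Finset.mul_sum, sum_PauliW_mul_PauliW, if_neg fun h => hv h.1.symm, mul_zero]
    · simp
  simp only [h', ← Finset.sum_mul, Matrix.trace, Matrix.diag, ← Finset.mul_sum]
  ring

theorem eq_of_PauliW_eq_smul [DecidableEq Q] {a b : Q → ZMod 2 × ZMod 2} {s : ℂ}
    (h : PauliW a = s • PauliW b) : a = b := by
  by_contra hab
  have := trace_PauliW_mul_PauliW a a
  nth_rw 2 [h] at this
  rw [Matrix.mul_smul, Matrix.trace_smul, trace_PauliW_mul_PauliW, if_neg hab, smul_zero,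
    if_pos rfl] at this
  exact pow_ne_zero _ two_ne_zero this.symm

end Tensor

/-! ### Conjugation by Clifford unitaries -/

/-- `U` maps every Pauli operator to a Pauli operator up to sign, by conjugation. -/
def PreservesPauli {n : ℕ} (U : Matrix (Fin n → ZMod 2) (Fin n → ZMod 2) ℂ) : Prop :=
  ∀ a : Fin n → ZMod 2 × ZMod 2, ∃ (b : Fin n → ZMod 2 × ZMod 2) (s : ℂ), (s = 1 ∨ s = -1) ∧
    U * PauliW a * U.conjTranspose = s • PauliW b

theorem preservesPauli_embedGate {n : ℕ} {G : Matrix (ZMod 2) (ZMod 2) ℂ}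
    (hG : ∀ a, ∃ (b : ZMod 2 × ZMod 2) (s : ℂ), (s = 1 ∨ s = -1) ∧
      G * pauli a * G.conjTranspose = s • pauli b) (i : Fin n) :
    PreservesPauli (embedGate n G i) := by
  intro a
  obtain ⟨b, s, hs, h⟩ := hG (a i)
  refine ⟨fun k => if k = i then b else a k, s, hs, ?_⟩
  rw [embedGate_eq_tensorOp, PauliW_eq_tensorOp, tensorOp_mul, tensorOp_conjTranspose,
    tensorOp_mul, PauliW_eq_tensorOp]
  have hprod : s = ∏ k : Fin n, if k = i then s else 1 := by simp
  conv_rhs => rw [hprod, ← tensorOp_smul]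
  congr 1
  funext k
  split_ifs with hk
  · rw [hk, h]
  · simp

/-- The permutation of the computational basis implemented by `cnotGate n i j`. -/
def cnotMap {n : ℕ} (i j : Fin n) (x : Fin n → ZMod 2) : Fin n → ZMod 2 :=
  Function.update x j (x j + x i)

theorem cnotGate_apply {n : ℕ} {i j : Fin n} (hij : i ≠ j) (x y : Fin n → ZMod 2) :
    cnotGate n i j x y = if y = cnotMap i j x then 1 else 0 := by
  simp only [cnotGate, Matrix.of_apply]
  refine if_congr ?_ rfl rfl
  constructor
  · rintro ⟨h1, h2, h3⟩
    funext k
    by_cases hkj : k = j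
    · subst hkj
      simp only [cnotMap, Function.update_self, h2, h1]
      linear_combination -CharTwo.add_self_eq_zero (y i)
    · rw [cnotMap, Function.update_of_ne hkj]
      by_cases hki : k = i
      · rw [hki, h1]
      · exact (h3 k hki hkj).symm
  · rintro rfl
    refine ⟨?_, ?_, fun k hki hkj => ?_⟩
    · rw [cnotMap, Function.update_of_ne hij]
    · rw [cnotMap, Function.update_of_ne hij, Function.update_self]
      linear_combination -CharTwo.add_self_eq_zero (x i)
    · rw [cnotMap, Function.update_of_ne hkj]

theorem preservesPauli_cnotGate {n : ℕ} {i j : Fin n} (hij : i ≠ j) :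
    PreservesPauli (cnotGate n i j) := by
  intro a
  obtain ⟨b, c, s, hs, h⟩ := exists_cnot_pauli (a i) (a j)
  refine ⟨Function.update (Function.update a i b) j c, s, hs, ?_⟩
  ext x y
  have hL : (cnotGate n i j * PauliW a * (cnotGate n i j).conjTranspose) x y =
      PauliW a (cnotMap i j x) (cnotMap i j y) := by
    simp [Matrix.mul_apply, Matrix.conjTranspose_apply, cnotGate_apply hij, apply_ite]
  rw [hL]
  have hj : j ∈ Finset.univ.erase i := by simp [hij.symm]
  simp only [PauliW, Matrix.of_apply, Matrix.smul_apply, smul_eq_mul]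
  rw [← Finset.mul_prod_erase _ _ (Finset.mem_univ i), ← Finset.mul_prod_erase _ _ hj,
    ← Finset.mul_prod_erase Finset.univ
      (fun k => pauli (Function.update (Function.update a i b) j c k) (x k) (y k))
      (Finset.mem_univ i), ← Finset.mul_prod_erase _ _ hj]
  have hrest : ∏ k ∈ (Finset.univ.erase i).erase j,
        pauli (a k) (cnotMap i j x k) (cnotMap i j y k) =
      ∏ k ∈ (Finset.univ.erase i).erase j,
        pauli (Function.update (Function.update a i b) j c k) (x k) (y k) := by
    refine Finset.prod_congr rfl fun k hk => ?_
    have hkj := Finset.ne_of_mem_erase hk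
    have hki := Finset.ne_of_mem_erase (Finset.mem_of_mem_erase hk)
    simp [cnotMap, hkj, hki]
  rw [hrest]
  have := h (x i) (y i) (x j) (y j)
  simp only [cnotMap, Function.update_self, Function.update_of_ne hij]
  linear_combination (∏ k ∈ (Finset.univ.erase i).erase j,
    pauli (Function.update (Function.update a i b) j c k) (x k) (y k)) * this

theorem PreservesPauli.mul {n : ℕ} {U V : Matrix (Fin n → ZMod 2) (Fin n → ZMod 2) ℂ}
    (hU : PreservesPauli U) (hV : PreservesPauli V) : PreservesPauli (U * V) := by
  intro a
  obtain ⟨b, s, hs, hb⟩ := hV a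
  obtain ⟨c, t, ht, hc⟩ := hU b
  refine ⟨c, s * t, by rcases hs with rfl | rfl <;> rcases ht with rfl | rfl <;> simp, ?_⟩
  calc U * V * PauliW a * (U * V).conjTranspose
      = U * (V * PauliW a * V.conjTranspose) * U.conjTranspose := by
        simp only [Matrix.conjTranspose_mul, Matrix.mul_assoc]
    _ = (s * t) • PauliW c := by
        rw [hb, Matrix.mul_smul, Matrix.smul_mul, hc, smul_smul]

theorem PreservesPauli.conjTranspose {n : ℕ} {U : Matrix (Fin n → ZMod 2) (Fin n → ZMod 2) ℂ}
    (hU : PreservesPauli U) (hUU : U.conjTranspose * U = 1) :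
    PreservesPauli U.conjTranspose := by
  have hcancel (A : Matrix (Fin n → ZMod 2) (Fin n → ZMod 2) ℂ) :
      U.conjTranspose * (U * A * U.conjTranspose) * U = A := by
    calc _ = (U.conjTranspose * U) * A * (U.conjTranspose * U) := by
          simp only [Matrix.mul_assoc]
      _ = A := by simp [hUU]
  choose F s hs hF using hU
  have hs2 (a) : s a * s a = 1 := by rcases hs a with h | h <;> simp [h]
  have hinv (a) : U.conjTranspose * PauliW (F a) * U = s a • PauliW a := by
    have := congrArg (fun M => s a • (U.conjTranspose * M * U)) (hF a)
    simp only [hcancel, Matrix.mul_smul, Matrix.smul_mul, smul_smul, hs2, one_smul] at this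
    exact this.symm
  have hinj : Function.Injective F := by
    intro a b hab
    have h := (hinv a).symm.trans (hab ▸ hinv b)
    refine eq_of_PauliW_eq_smul (s := s a * s b) ?_
    rw [mul_smul, ← h, smul_smul, hs2, one_smul]
  intro b
  obtain ⟨a, rfl⟩ := Finite.injective_iff_surjective.mp hinj b
  exact ⟨a, s a, hs a, by rw [Matrix.conjTranspose_conjTranspose, hinv]⟩

theorem preservesPauli_of_mem_CliffordGroup {n : ℕ}
    {U : Matrix.unitaryGroup (Fin n → ZMod 2) ℂ} (hU : U ∈ CliffordGroup n) :
    PreservesPauli (U : Matrix (Fin n → ZMod 2) (Fin n → ZMod 2) ℂ) := by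
  induction hU using Subgroup.closure_induction with
  | mem V hV =>
    simp only [cliffordGens, Set.mem_ofPred_eq, Set.mem_union, Set.mem_iUnion,
      Set.mem_singleton_iff] at hV
    obtain (⟨i, hV⟩ | ⟨i, hV⟩) | ⟨i, j, hij, hV⟩ := hV <;> rw [hV]
    · exact preservesPauli_embedGate exists_hGate_conj_pauli i
    · exact preservesPauli_embedGate exists_sGate_conj_pauli i
    · exact preservesPauli_cnotGate hij
  | one => exact fun a => ⟨a, 1, by simp, by simp⟩
  | mul V W _ _ hV hW => exact hV.mul hW
  | inv V _ hV => exact hV.conjTranspose (Matrix.mem_unitaryGroup_iff'.mp V.2)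

/-! ### Entries of Clifford unitaries -/

/-- The ring `ℤ[i, 1/2]` of dyadic Gaussian rationals, as a subring of `ℂ`. -/
def dyadicGaussian : Subring ℂ where
  carrier := {z | ∃ (k : ℕ) (g : GaussianInt), z * 2 ^ k = g.toComplex}
  zero_mem' := ⟨0, 0, by simp⟩
  one_mem' := ⟨0, 1, by simp⟩
  add_mem' := by
    rintro z w ⟨k, g, hg⟩ ⟨l, h, hh⟩
    refine ⟨k + l, g * 2 ^ l + h * 2 ^ k, ?_⟩
    simp only [map_add, map_mul, map_pow, map_ofNat, ← hg, ← hh]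
    ring
  mul_mem' := by
    rintro z w ⟨k, g, hg⟩ ⟨l, h, hh⟩
    refine ⟨k + l, g * h, ?_⟩
    rw [map_mul, ← hg, ← hh]
    ring
  neg_mem' := by
    rintro z ⟨k, g, hg⟩
    exact ⟨k, -g, by rw [map_neg, ← hg, neg_mul]⟩

theorem I_mem_dyadicGaussian : Complex.I ∈ dyadicGaussian :=
  ⟨0, ⟨0, 1⟩, by simp [GaussianInt.toComplex_def]⟩

theorem star_mem_dyadicGaussian {z : ℂ} (hz : z ∈ dyadicGaussian) :
    star z ∈ dyadicGaussian := by
  obtain ⟨k, g, hg⟩ := hz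
  refine ⟨k, star g, ?_⟩
  have := congrArg star hg
  simp only [star_mul', star_pow, star_ofNat] at this
  rw [this, GaussianInt.toComplex_star]
  rfl

theorem hGate_mem_dyadicGaussian (x y : ZMod 2) : hGate x y ∈ dyadicGaussian := by
  have h : (1 + Complex.I) / 2 ∈ dyadicGaussian :=
    ⟨1, ⟨1, 1⟩, by simp [GaussianInt.toComplex_def]⟩
  simp only [hGate, Matrix.of_apply]
  refine mul_mem h ?_
  split_ifs
  · exact neg_mem (one_mem _)
  · exact one_mem _

theorem sGate_mem_dyadicGaussian (x y : ZMod 2) : sGate x y ∈ dyadicGaussian := by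
  simp only [sGate, Matrix.of_apply]
  split_ifs
  · exact one_mem _
  · exact neg_mem I_mem_dyadicGaussian
  · exact zero_mem _

theorem embedGate_mem_dyadicGaussian {n : ℕ} {G : Matrix (ZMod 2) (ZMod 2) ℂ}
    (hG : ∀ x y, G x y ∈ dyadicGaussian) (i : Fin n) (x y : Fin n → ZMod 2) :
    embedGate n G i x y ∈ dyadicGaussian := by
  refine mul_mem (hG _ _) (prod_mem fun k _ => ?_)
  split_ifs
  · exact one_mem _
  · exact zero_mem _

theorem entry_mem_dyadicGaussian {n : ℕ} {U : Matrix.unitaryGroup (Fin n → ZMod 2) ℂ}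
    (hU : U ∈ CliffordGroup n) :
    ∀ x y, (U : Matrix (Fin n → ZMod 2) (Fin n → ZMod 2) ℂ) x y ∈ dyadicGaussian := by
  induction hU using Subgroup.closure_induction with
  | mem V hV =>
    simp only [cliffordGens, Set.mem_ofPred_eq, Set.mem_union, Set.mem_iUnion,
      Set.mem_singleton_iff] at hV
    obtain (⟨i, hV⟩ | ⟨i, hV⟩) | ⟨i, j, hij, hV⟩ := hV <;> rw [hV]
    · exact embedGate_mem_dyadicGaussian hGate_mem_dyadicGaussian i
    · exact embedGate_mem_dyadicGaussian sGate_mem_dyadicGaussian i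
    · intro x y
      rw [cnotGate_apply hij]
      split_ifs
      · exact one_mem _
      · exact zero_mem _
  | one =>
    intro x y
    rw [Matrix.UnitaryGroup.one_val, Matrix.one_apply]
    split_ifs
    · exact one_mem _
    · exact zero_mem _
  | mul V W _ _ hV hW =>
    intro x y
    rw [Matrix.UnitaryGroup.mul_val, Matrix.mul_apply]
    exact sum_mem fun z _ => mul_mem (hV x z) (hW z y)
  | inv V _ hV => exact fun x y => star_mem_dyadicGaussian (hV y x)

theorem pow_four_of_sq_add_sq_eq_two_pow (j : ℕ) :
    ∀ a b : ℤ, a ^ 2 + b ^ 2 = 2 ^ j → ((a : ℂ) + b * Complex.I) ^ 4 = (-4) ^ j := by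
  induction j with
  | zero =>
    intro a b h
    have hI4 : Complex.I ^ 4 = 1 := Complex.I_pow_four
    have ha : a ^ 2 = 0 ∨ b ^ 2 = 0 := by
      by_contra! hne
      have := pow_pos (abs_pos.mpr (pow_ne_zero_iff two_ne_zero |>.mp hne.1)) 2
      have := pow_pos (abs_pos.mpr (pow_ne_zero_iff two_ne_zero |>.mp hne.2)) 2
      simp only [sq_abs] at *
      omega
    rcases ha with ha | hb
    · have hb : (b : ℂ) ^ 2 = 1 := by exact_mod_cast (by omega : b ^ 2 = 1)
      have ha : (a : ℂ) = 0 := by exact_mod_cast pow_eq_zero_iff two_ne_zero |>.mp ha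
      rw [ha, zero_add, mul_pow, hI4]
      linear_combination (b ^ 2 + 1 : ℂ) * hb
    · have ha : (a : ℂ) ^ 2 = 1 := by exact_mod_cast (by omega : a ^ 2 = 1)
      have hb : (b : ℂ) = 0 := by exact_mod_cast pow_eq_zero_iff two_ne_zero |>.mp hb
      rw [hb, zero_mul, add_zero]
      linear_combination (a ^ 2 + 1 : ℂ) * ha
  | succ j ih =>
    intro a b h
    have hpar : Even (a + b) := by
      have : Even (a ^ 2 + b ^ 2) := by
        rw [h, pow_succ]
        exact even_two.mul_left _
      simpa [Int.even_add, Int.even_pow] using this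
    obtain ⟨c, hc⟩ := hpar
    have hb : b = 2 * c - a := by omega
    subst hb
    have h' : c ^ 2 + (c - a) ^ 2 = 2 ^ j := by
      rw [pow_succ 2 j] at h
      linarith
    have hI : Complex.I ^ 2 = -1 := Complex.I_sq
    have hfac : (a : ℂ) + ((2 * c - a : ℤ) : ℂ) * Complex.I =
        (1 + Complex.I) * ((c : ℂ) + ((c - a : ℤ) : ℂ) * Complex.I) := by
      push_cast
      linear_combination (a - c : ℂ) * hI
    have h4 : (1 + Complex.I) ^ 4 = -4 := by
      linear_combination (Complex.I ^ 2 + 4 * Complex.I + 5) * hI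
    rw [hfac, mul_pow, ih _ _ h', h4, pow_succ]
    ring

theorem pow_four_of_mem_dyadicGaussian {z : ℂ} (hz : z ∈ dyadicGaussian) {m : ℕ}
    (h : z * star z = 2 ^ m) : z ^ 4 = (-4) ^ m := by
  obtain ⟨k, g, hg⟩ := hz
  have hnorm : g.re ^ 2 + g.im ^ 2 = 2 ^ (m + 2 * k) := by
    have hI : Complex.I ^ 2 = -1 := Complex.I_sq
    have hstar : star z * 2 ^ k = g.re - g.im * Complex.I := by
      have := congrArg star hg
      simpa [GaussianInt.toComplex_def, sub_eq_add_neg, mul_comm] using this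
    rw [GaussianInt.toComplex_def] at hg
    have : (g.re : ℂ) ^ 2 + (g.im : ℂ) ^ 2 = 2 ^ (m + 2 * k) := by
      rw [pow_add, ← h, two_mul, pow_add]
      linear_combination (-(star z * 2 ^ k)) * hg - (g.re + g.im * Complex.I) * hstar
        + (g.im : ℂ) ^ 2 * hI
    exact_mod_cast this
  have h4 := pow_four_of_sq_add_sq_eq_two_pow _ _ _ hnorm
  rw [← GaussianInt.toComplex_def, ← hg, mul_pow, pow_add, pow_mul, ← pow_mul, mul_comm k,
    pow_mul] at h4
  norm_num at h4
  exact h4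

/-! ### The labels fixed up to sign -/

section SignFixed

variable {n : ℕ} {A : Matrix (Fin n → ZMod 2) (Fin n → ZMod 2) ℂ}

/-- The Pauli labels `a` with `A W_a A^† = ±W_a`. -/
def signFixed (A : Matrix (Fin n → ZMod 2) (Fin n → ZMod 2) ℂ) :
    Set (Fin n → ZMod 2 × ZMod 2) :=
  {a | A * PauliW a * A.conjTranspose = PauliW a ∨ A * PauliW a * A.conjTranspose = -PauliW a}

theorem mem_signFixed_iff {a : Fin n → ZMod 2 × ZMod 2} :
    a ∈ signFixed A ↔
      ∃ s : ℂ, (s = 1 ∨ s = -1) ∧ A * PauliW a * A.conjTranspose = s • PauliW a := by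
  constructor
  · rintro (h | h)
    · exact ⟨1, by simp, by simpa using h⟩
    · exact ⟨-1, by simp, by simpa using h⟩
  · rintro ⟨s, rfl | rfl, h⟩
    · exact Or.inl (by simpa using h)
    · exact Or.inr (by simpa using h)

theorem conj_PauliW_add (hA : A.conjTranspose * A = 1) {a b : Fin n → ZMod 2 × ZMod 2}
    {s t : ℂ} (ha : A * PauliW a * A.conjTranspose = s • PauliW a)
    (hb : A * PauliW b * A.conjTranspose = t • PauliW b) :
    A * PauliW (a + b) * A.conjTranspose = (s * t) • PauliW (a + b) := by
  obtain ⟨k, hk, h⟩ := exists_PauliW_mul_PauliW a b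
  have hmul : A * (PauliW a * PauliW b) * A.conjTranspose =
      (A * PauliW a * A.conjTranspose) * (A * PauliW b * A.conjTranspose) := by
    calc _ = A * PauliW a * (1 * (PauliW b * A.conjTranspose)) := by
          simp only [Matrix.mul_assoc, Matrix.one_mul]
      _ = _ := by rw [← hA]; simp only [Matrix.mul_assoc]
  rw [ha, hb, h, Matrix.mul_smul, Matrix.smul_mul, Matrix.smul_mul, Matrix.mul_smul, h] at hmul
  refine smul_right_injective _ hk ?_
  simp only [hmul, smul_smul]
  congr 1
  ring

theorem exists_ncard_signFixed_eq_two_pow (hA : A.conjTranspose * A = 1) :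
    ∃ m : ℕ, (signFixed A).ncard = 2 ^ m := by
  have hzero : PauliW (0 : Fin n → ZMod 2 × ZMod 2) = 1 := by
    ext x y
    have h0 : (0 : ZMod 2 × ZMod 2) = (0, 0) := rfl
    simp [PauliW, pauli, Matrix.one_apply, Finset.prod_ite_zero, funext_iff, h0]
  have hneg (a : Fin n → ZMod 2 × ZMod 2) : -a = a :=
    funext fun i => Prod.ext (ZMod.neg_eq_self_mod_two _) (ZMod.neg_eq_self_mod_two _)
  let H : AddSubgroup (Fin n → ZMod 2 × ZMod 2) :=
    { carrier := signFixed A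
      zero_mem' := Or.inl (by rw [hzero, Matrix.mul_one, mul_eq_one_comm.mp hA])
      add_mem' := fun {a b} ha hb => by
        obtain ⟨s, hs, ha⟩ := mem_signFixed_iff.mp ha
        obtain ⟨t, ht, hb⟩ := mem_signFixed_iff.mp hb
        refine mem_signFixed_iff.mpr ⟨s * t, ?_, conj_PauliW_add hA ha hb⟩
        rcases hs with rfl | rfl <;> rcases ht with rfl | rfl <;> simp
      neg_mem' := fun {a} ha => by rwa [hneg] }
  have hdvd : Nat.card H ∣ 2 ^ (2 * n) := by
    have := H.card_addSubgroup_dvd_card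
    simpa [Nat.card_prod, ← pow_mul, ← sq, pow_mul] using this
  obtain ⟨m, -, hm⟩ := (Nat.dvd_prime_pow Nat.prime_two).mp hdvd
  exact ⟨m, hm⟩

theorem trace_mul_star_trace_eq_ncard (hA : A.conjTranspose * A = 1) (hP : PreservesPauli A)
    (htr : A.trace ≠ 0) : A.trace * star A.trace = (signFixed A).ncard := by
  classical
  let χ (a : Fin n → ZMod 2 × ZMod 2) : ℂ :=
    (PauliW a * (A * PauliW a * A.conjTranspose)).trace / 2 ^ n
  have hχ {a : Fin n → ZMod 2 × ZMod 2} {s : ℂ}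
      (h : A * PauliW a * A.conjTranspose = s • PauliW a) : χ a = s := by
    simp [χ, h, trace_PauliW_mul_PauliW]
  have hχ0 {a : Fin n → ZMod 2 × ZMod 2} (h : a ∉ signFixed A) : χ a = 0 := by
    obtain ⟨b, s, hs, hb⟩ := hP a
    have hab : a ≠ b := by
      rintro rfl
      exact h (mem_signFixed_iff.mpr ⟨s, hs, hb⟩)
    simp [χ, hb, trace_PauliW_mul_PauliW, hab]
  have hsum : ∑ a, χ a = A.trace * star A.trace := by
    simp only [χ]
    rw [← Finset.sum_div, sum_trace_PauliW_conj, Matrix.trace_conjTranspose]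
    simp
  have hadd_self (a : Fin n → ZMod 2 × ZMod 2) : a + a = 0 :=
    funext fun i => Prod.ext (CharTwo.add_self_eq_zero _) (CharTwo.add_self_eq_zero _)
  have hone {a : Fin n → ZMod 2 × ZMod 2} (ha : a ∈ signFixed A) : χ a = 1 := by
    obtain ⟨s, rfl | rfl, h⟩ := mem_signFixed_iff.mp ha
    · exact hχ h
    · exfalso
      have hshift (b) : χ (b + a) = -χ b := by
        by_cases hb : b ∈ signFixed A
        · obtain ⟨t, ht, hb⟩ := mem_signFixed_iff.mp hb
          rw [hχ (conj_PauliW_add hA hb h), hχ hb, mul_neg_one]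
        · have hba : b + a ∉ signFixed A := by
            intro hba
            obtain ⟨t, ht, hba⟩ := mem_signFixed_iff.mp hba
            have := conj_PauliW_add hA hba h
            rw [add_assoc, hadd_self, add_zero] at this
            exact hb (mem_signFixed_iff.mpr ⟨_, by rcases ht with rfl | rfl <;> simp, this⟩)
          rw [hχ0 hb, hχ0 hba, neg_zero]
      have hzero : ∑ b, χ b = -∑ b, χ b := by
        rw [← Finset.sum_neg_distrib, ← Equiv.sum_comp (Equiv.addRight a)]
        exact Finset.sum_congr rfl fun b _ => hshift b
      rw [self_eq_neg, hsum] at hzero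
      exact mul_ne_zero htr (star_ne_zero.mpr htr) hzero
  rw [← hsum, Set.ncard_eq_toFinset_card', Finset.card_eq_sum_ones, Nat.cast_sum,
    ← Finset.sum_subset (Finset.subset_univ (signFixed A).toFinset)
      fun a _ ha => hχ0 (by simpa using ha)]
  exact Finset.sum_congr rfl fun a ha => by rw [hone (by simpa using ha), Nat.cast_one]

end SignFixed

/-- For a Clifford unitary `U` with `tr U ≠ 0`, the number of `a ∈ 𝔽₂^{2n}`
with `U W_a U^† = ±W_a` is a power `2^m`, and `(tr U)^4 = (−4)^m`. -/
theorem stmt8 (n : ℕ) (hn : 1 ≤ n)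
    (U : Matrix.unitaryGroup (Fin n → ZMod 2) ℂ) (hU : U ∈ CliffordGroup n)
    (htr : Matrix.trace (U : Matrix (Fin n → ZMod 2) (Fin n → ZMod 2) ℂ) ≠ 0) :
    ∃ m : ℕ,
      Set.ncard {a : Fin n → ZMod 2 × ZMod 2 |
          (U : Matrix (Fin n → ZMod 2) (Fin n → ZMod 2) ℂ) * PauliW a *
              (U : Matrix (Fin n → ZMod 2) (Fin n → ZMod 2) ℂ).conjTranspose = PauliW a ∨
            (U : Matrix (Fin n → ZMod 2) (Fin n → ZMod 2) ℂ) * PauliW a *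
              (U : Matrix (Fin n → ZMod 2) (Fin n → ZMod 2) ℂ).conjTranspose = -PauliW a}
        = 2 ^ m ∧
      (Matrix.trace (U : Matrix (Fin n → ZMod 2) (Fin n → ZMod 2) ℂ)) ^ 4
        = (-4 : ℂ) ^ m := by
  have hUU := Matrix.mem_unitaryGroup_iff'.mp U.2
  obtain ⟨m, hm⟩ := exists_ncard_signFixed_eq_two_pow hUU
  refine ⟨m, hm, pow_four_of_mem_dyadicGaussian
    (sum_mem fun x _ => entry_mem_dyadicGaussian hU x x) ?_⟩
  have h := trace_mul_star_trace_eq_ncard hUU (preservesPauli_of_mem_CliffordGroup hU) htr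
  rw [hm] at h
  exact_mod_cast h


end
end

section
/- Let a, b ∈ ℤ and m ∈ ℕ satisfy a² + b² = 2^m. Then, in ℂ, (a + b·i)^4 = (−4)^m. -/
/-- If `a, b ∈ ℤ` and `m ∈ ℕ` satisfy `a² + b² = 2^m`, then in `ℂ`,
`(a + b·i)^4 = (−4)^m`. -/
theorem stmt9 (a b : ℤ) (m : ℕ) (h : a ^ 2 + b ^ 2 = 2 ^ m) :
    ((a : ℂ) + (b : ℂ) * Complex.I) ^ 4 = (-4 : ℂ) ^ m := by
  induction m generalizing a b with
  | zero =>
    have ha₁ : -1 ≤ a := by nlinarith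
    have ha₂ : a ≤ 1 := by nlinarith
    have hb₁ : -1 ≤ b := by nlinarith
    have hb₂ : b ≤ 1 := by nlinarith
    interval_cases a <;> interval_cases b <;> simp_all [Even.neg_pow (show Even 4 by decide)]
  | succ m ih =>
    -- `a` and `b` have the same parity, so `a + b * I` is divisible by `1 + I`.
    have hpar : Even (a + b) := by
      have : Even (a ^ 2 + b ^ 2) := by rw [h, pow_succ]; exact even_two.mul_left _
      simpa [Int.even_add, Int.even_pow] using this
    obtain ⟨c, hc⟩ := hpar
    obtain ⟨d, rfl⟩ : ∃ d, b = c + d := ⟨b - c, by ring⟩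
    obtain rfl : a = c - d := by linarith
    have hcd : c ^ 2 + d ^ 2 = 2 ^ m := by linarith [h, pow_succ (2 : ℤ) m]
    have hI : (1 + Complex.I) ^ 4 = -4 := by
      linear_combination (Complex.I ^ 2 + 4 * Complex.I + 5) * Complex.I_sq
    have hfac : ((c - d : ℤ) : ℂ) + ((c + d : ℤ) : ℂ) * Complex.I
        = (c + d * Complex.I) * (1 + Complex.I) := by
      push_cast
      linear_combination -(d : ℂ) * Complex.I_sq
    rw [hfac, mul_pow, ih c d hcd, hI, pow_succ]
end

section
/- Let n ≥ 1 and d = 2^n. Then tr((P_{n,4} ⊗ P_{n,4}) · P_[8]) = C(d+7, 8) · 16(d² + 15d + 68) / (d²(d+3)(d+5)(d+6)(d+7)), where P_[8] := (1/8!)·Σ_{σ∈S_8} U_σ is the orthogonal projector onto the symmetric subspace Sym_8(ℂ^d) ⊆ (ℂ^d)^{⊗8} and C(d+7, 8) is its rank. (Equivalently, for ψ drawn from the uniform probability measure on the unit sphere of ℂ^d, E[α_+(ψ)²] = 16(d² + 15d + 68)/(d²(d+3)(d+5)(d+6)(d+7)), where α_+(ψ) := tr(P_{n,4}·(|ψ⟩⟨ψ|)^{⊗4}).)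 -/
open scoped BigOperators

noncomputable section

/-- `P_{n,4} ⊗ P_{n,4}` acting on `(ℂ^d)^{⊗8}` under the canonical identification
`(ℂ^d)^{⊗4} ⊗ (ℂ^d)^{⊗4} ≅ (ℂ^d)^{⊗8}`. -/
def stabProjPair (n : ℕ) :
    Matrix (Fin 8 → (Fin n → ZMod 2)) (Fin 8 → (Fin n → ZMod 2)) ℂ :=
  Matrix.of fun x y =>
    stabProj n 4 (fun i : Fin 4 => x ⟨i.val, by have := i.isLt; omega⟩)
        (fun i : Fin 4 => y ⟨i.val, by have := i.isLt; omega⟩) *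
      stabProj n 4 (fun i : Fin 4 => x ⟨i.val + 4, by have := i.isLt; omega⟩)
        (fun i : Fin 4 => y ⟨i.val + 4, by have := i.isLt; omega⟩)

/-- Sum of `f a rest` over all ways of splitting an entry `a` off the list. -/
def pickSum {α : Type*} : List α → (α → List α → ℕ) → ℕ
  | [], _ => 0
  | a :: l, f => f a l + pickSum l fun b r => f b (a :: r)

theorem pickSum_ofFn {α : Type*} : ∀ {n : ℕ} (v : Fin (n + 1) → α) (f : α → List α → ℕ),
    pickSum (List.ofFn v) f = ∑ p, f (v p) (List.ofFn fun i => v (p.succAbove i))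
  | 0, v, f => by simp [pickSum]
  | n + 1, v, f => by
    rw [List.ofFn_succ, pickSum, pickSum_ofFn (fun i => v i.succ)]
    conv_rhs => rw [Fin.sum_univ_succ]
    simp [List.ofFn_succ]

/-- Sum of `G (m &&& (r₀ ^^^ v_{σ 0}) &&& (r₁ ^^^ v_{σ 1}) &&& ⋯)` over all matchings `σ` of the
rows `r` with the columns `v`. -/
def matchSum (G : ℕ → ℕ) : List ℕ → List ℕ → ℕ → ℕ
  | [], _, m => G m
  | r :: rs, vs, m => pickSum vs fun v rest => matchSum G rs rest (m &&& (r ^^^ v))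

/-- The number with base-`512` digits `P 0, …, P (N - 1)`. -/
def spread (P : ℕ → Bool) : ℕ → ℕ
  | 0 => 0
  | N + 1 => 2 ^ 9 * spread (fun w => P (w + 1)) N + (P 0).toNat

theorem testBit_spread (N : ℕ) : ∀ (P : ℕ → Bool) (k : ℕ),
    (spread P N).testBit k = (decide (k % 9 = 0) && decide (k / 9 < N) && P (k / 9)) := by
  induction N with
  | zero => simp [spread]
  | succ N ih =>
    intro P k
    rw [spread, Nat.testBit_two_pow_mul_add _ (by cases P 0 <;> simp), ih]
    split_ifs with h
    · rw [Nat.div_eq_of_lt h, Nat.mod_eq_of_lt h]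
      rcases Nat.eq_zero_or_pos k with rfl | hk
      · cases P 0 <;> simp
      · cases P 0 <;> simp [hk.ne', Nat.testBit_eq_false_of_lt (Nat.one_lt_two_pow hk.ne')]
    · obtain ⟨j, rfl⟩ : ∃ j, k = j + 9 := ⟨k - 9, by omega⟩
      simp

theorem spread_land_xor (A P Q : ℕ → Bool) (N : ℕ) :
    spread A N &&& (spread P N ^^^ spread Q N) = spread (fun w => A w && (P w ^^ Q w)) N := by
  refine Nat.eq_of_testBit_eq fun k => ?_
  simp only [Nat.testBit_and, Nat.testBit_xor, testBit_spread]
  generalize decide (k % 9 = 0) = a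
  generalize decide (k / 9 < N) = b
  cases a <;> cases b <;> simp

theorem spread_mod (N : ℕ) : ∀ P : ℕ → Bool,
    spread P N % 511 = (∑ w : Fin N, (P w).toNat) % 511 := by
  induction N with
  | zero => simp [spread]
  | succ N ih =>
    intro P
    have h := ih fun w => P (w + 1)
    rw [spread, Fin.sum_univ_succ]
    simp only [Fin.val_succ, Fin.val_zero]
    omega

/-- The permutation of `Fin (n + 1)` sending `0` to `p` and `i + 1` to `p.succAbove (e i)`. -/
def permCons {n : ℕ} (x : Fin (n + 1) × Equiv.Perm (Fin n)) : Equiv.Perm (Fin (n + 1)) :=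
  ((finSuccEquiv' 0).trans (Equiv.optionCongr x.2)).trans (finSuccEquiv' x.1).symm

theorem permCons_zero {n : ℕ} (x : Fin (n + 1) × Equiv.Perm (Fin n)) : permCons x 0 = x.1 := by
  simp [permCons]

theorem permCons_succ {n : ℕ} (x : Fin (n + 1) × Equiv.Perm (Fin n)) (i : Fin n) :
    permCons x i.succ = x.1.succAbove (x.2 i) := by
  simp [permCons, finSuccEquiv'_zero]

theorem permCons_bijective {n : ℕ} : Function.Bijective (@permCons n) := by
  rw [Fintype.bijective_iff_injective_and_card]
  refine ⟨fun x y h => ?_, by simp [Fintype.card_perm, Nat.factorial_succ]⟩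
  have h1 : x.1 = y.1 := by rw [← permCons_zero x, h, permCons_zero]
  refine Prod.ext h1 (Equiv.ext fun i => ?_)
  have h2 := permCons_succ x i
  rw [h, permCons_succ, h1] at h2
  exact (Fin.succAbove_right_injective h2).symm

theorem matchSum_spread (G : ℕ → ℕ) (N : ℕ) : ∀ {n : ℕ} (P Q : Fin n → ℕ → Bool) (A : ℕ → Bool),
    matchSum G (List.ofFn fun i => spread (P i) N) (List.ofFn fun i => spread (Q i) N)
        (spread A N) =
      ∑ σ : Equiv.Perm (Fin n),
        G (spread (fun w => A w && decide (∀ i, (P i w ^^ Q (σ i) w) = true)) N)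
  | 0, P, Q, A => by simp [matchSum]
  | n + 1, P, Q, A => by
    rw [List.ofFn_succ (f := fun i => spread (P i) N), matchSum, pickSum_ofFn,
      ← permCons_bijective.sum_comp, Fintype.sum_prod_type]
    refine Finset.sum_congr rfl fun p _ => ?_
    rw [spread_land_xor,
      matchSum_spread G N (fun i => P i.succ) (fun i => Q (p.succAbove i))]
    refine Finset.sum_congr rfl fun e _ => ?_
    simp only [Fin.forall_fin_succ, permCons_zero, permCons_succ, Bool.decide_and,
      Bool.and_assoc, Bool.decide_eq_true]

/-- The even-weight pair of words with free coordinates `b 0, b 1, b 2` and `b 4, b 5, b 6`. -/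
def evenWord (b : Fin 8 → ZMod 2) : Fin 8 → ZMod 2 :=
  ![b 0, b 1, b 2, b 0 + b 1 + b 2, b 4, b 5, b 6, b 4 + b 5 + b 6]

/-- The block-constant word with values `b 3` and `b 7`. -/
def blockShift (b : Fin 8 → ZMod 2) : Fin 8 → ZMod 2 :=
  ![b 3, b 3, b 3, b 3, b 7, b 7, b 7, b 7]

/-- The eight low binary digits of `w`. -/
def bits (w : ℕ) (i : Fin 8) : ZMod 2 := if w.testBit i then 1 else 0

theorem bits_bijective : Function.Bijective fun w : Fin 256 => bits w := by
  rw [Fintype.bijective_iff_injective_and_card]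
  refine ⟨fun x y h => Fin.ext (Nat.eq_of_testBit_eq fun k => ?_), by simp [ZMod.card]⟩
  rcases lt_or_ge k 8 with hk | hk
  · have := congrFun h ⟨k, hk⟩
    simp only [bits] at this
    revert this
    cases (x : ℕ).testBit k <;> cases (y : ℕ).testBit k <;> simp
  · have h2 : 256 ≤ 2 ^ k := (by norm_num : 256 = 2 ^ 8) ▸ Nat.pow_le_pow_right (by norm_num) hk
    rw [Nat.testBit_eq_false_of_lt (x.2.trans_le h2), Nat.testBit_eq_false_of_lt (y.2.trans_le h2)]

/-- The number of pairs of even words which `σ` changes by a block-constant word. -/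
def fixCount (σ : Equiv.Perm (Fin 8)) : ℕ :=
  (Finset.univ.filter fun b : Fin 8 → ZMod 2 =>
    ∀ i, evenWord b (σ i) = evenWord b i + blockShift b i).card

/-- Injective encoding of the possible values of `fixCount` by powers of `2 ^ 16`. -/
def weight : ℕ → ℕ
  | 0 => 0
  | c + 1 =>
    bif Nat.beq c 1 then 1 else bif Nat.beq c 3 then 2 ^ 16 else
    bif Nat.beq c 7 then 2 ^ 32 else bif Nat.beq c 15 then 2 ^ 48 else
    bif Nat.beq c 31 then 2 ^ 64 else bif Nat.beq c 63 then 2 ^ 80 else 0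

theorem weight_eq (c : ℕ) : weight c =
    (if c = 2 then 1 else 0) + (if c = 4 then 1 else 0) * 2 ^ 16 +
    (if c = 8 then 1 else 0) * 2 ^ 32 + (if c = 16 then 1 else 0) * 2 ^ 48 +
    (if c = 32 then 1 else 0) * 2 ^ 64 + (if c = 64 then 1 else 0) * 2 ^ 80 := by
  cases c with
  | zero => simp [weight]
  | succ c =>
    have hb : ∀ k, Nat.beq c k = decide (c = k) := fun k => by
      rw [Bool.eq_iff_iff]; simp
    simp only [weight, hb, Bool.cond_decide, Nat.reduceEqDiff]
    split_ifs <;> omega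

/-- Predicate for the `i`-th row mask. -/
def rowPred (i : Fin 8) (w : ℕ) : Bool :=
  decide (evenWord (bits w) i + blockShift (bits w) i = 0)

/-- Predicate for the `i`-th column mask. -/
def colPred (i : Fin 8) (w : ℕ) : Bool := decide (evenWord (bits w) i = 1)

theorem rowPred_xor_colPred (i j : Fin 8) (w : ℕ) : (rowPred i w ^^ colPred j w) = true ↔
    evenWord (bits w) j = evenWord (bits w) i + blockShift (bits w) i := by
  have key : ∀ x y : ZMod 2, (decide (x = 0) ^^ decide (y = 1)) = true ↔ y = x := by decide
  exact key _ _

theorem spread_mod_eq_fixCount (σ : Equiv.Perm (Fin 8)) :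
    spread (fun w => true && decide (∀ i, (rowPred i w ^^ colPred (σ i) w) = true)) 256 % 511 =
      fixCount σ := by
  have h : ∑ w : Fin 256,
      (true && decide (∀ i, (rowPred i w ^^ colPred (σ i) w) = true)).toNat = fixCount σ := by
    simp only [rowPred_xor_colPred, Bool.true_and]
    rw [fixCount, Finset.card_filter, ← bits_bijective.sum_comp]
    refine Finset.sum_congr rfl fun w _ => ?_
    split_ifs with h <;> simp [h]
  rw [spread_mod, h, Nat.mod_eq_of_lt]
  refine lt_of_le_of_lt (Finset.card_le_univ _) ?_
  simp [ZMod.card]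

set_option maxRecDepth 100000 in
theorem matchSum_masks :
    matchSum (fun m => weight (m % 511))
      [spread (rowPred 0) 256, spread (rowPred 1) 256, spread (rowPred 2) 256,
        spread (rowPred 3) 256, spread (rowPred 4) 256, spread (rowPred 5) 256,
        spread (rowPred 6) 256, spread (rowPred 7) 256]
      [spread (colPred 0) 256, spread (colPred 1) 256, spread (colPred 2) 256,
        spread (colPred 3) 256, spread (colPred 4) 256, spread (colPred 5) 256,
        spread (colPred 6) 256, spread (colPred 7) 256]
      (spread (fun _ => true) 256) =
    8704 + 17152 * 2 ^ 16 + 11104 * 2 ^ 32 + 2992 * 2 ^ 48 + 352 * 2 ^ 64 + 16 * 2 ^ 80 := by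
  decide +kernel

theorem sum_weight_fixCount : ∑ σ, weight (fixCount σ) =
    8704 + 17152 * 2 ^ 16 + 11104 * 2 ^ 32 + 2992 * 2 ^ 48 + 352 * 2 ^ 64 + 16 * 2 ^ 80 := by
  rw [← matchSum_masks]
  have h := matchSum_spread (fun m => weight (m % 511)) 256 rowPred colPred fun _ => true
  simp only [spread_mod_eq_fixCount] at h
  rw [← h]
  simp [List.ofFn_succ]

theorem digits_unique {a b c d e f : ℕ} (ha : a ≤ 40320) (hb : b ≤ 40320) (hc : c ≤ 40320)
    (hd : d ≤ 40320) (he : e ≤ 40320)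
    (h : a + b * 2 ^ 16 + c * 2 ^ 32 + d * 2 ^ 48 + e * 2 ^ 64 + f * 2 ^ 80 =
      8704 + 17152 * 2 ^ 16 + 11104 * 2 ^ 32 + 2992 * 2 ^ 48 + 352 * 2 ^ 64 + 16 * 2 ^ 80) :
    a = 8704 ∧ b = 17152 ∧ c = 11104 ∧ d = 2992 ∧ e = 352 ∧ f = 16 := by
  omega

theorem sum_comp_of_sum_weight {α : Type*} [Fintype α] (F : α → ℕ)
    (hα : Fintype.card α = 40320)
    (hw : ∑ x, weight (F x) =
      8704 + 17152 * 2 ^ 16 + 11104 * 2 ^ 32 + 2992 * 2 ^ 48 + 352 * 2 ^ 64 + 16 * 2 ^ 80)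
    (g : ℕ → ℂ) : ∑ x, g (F x) =
      8704 * g 2 + 17152 * g 4 + 11104 * g 8 + 2992 * g 16 + 352 * g 32 + 16 * g 64 := by
  simp only [weight_eq, Finset.sum_add_distrib, ← Finset.sum_mul, ← Finset.card_filter] at hw
  have hle : ∀ c, (Finset.univ.filter fun x => F x = c).card ≤ 40320 := fun c =>
    hα ▸ Finset.card_le_univ _
  obtain ⟨c2, c4, c8, c16, c32, c64⟩ :=
    digits_unique (hle 2) (hle 4) (hle 8) (hle 16) (hle 32) hw
  have key : ∀ h : ℕ → ℂ, ∑ x with F x ∈ ({2, 4, 8, 16, 32, 64} : Finset ℕ), h (F x) =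
      8704 * h 2 + 17152 * h 4 + 11104 * h 8 + 2992 * h 16 + 352 * h 32 + 16 * h 64 := by
    intro h
    rw [← Finset.sum_fiberwise_of_maps_to (g := F) (t := {2, 4, 8, 16, 32, 64})
      (fun x hx => (Finset.mem_filter.1 hx).2)]
    have hfib : ∀ c ∈ ({2, 4, 8, 16, 32, 64} : Finset ℕ),
        ∑ x ∈ Finset.univ.filter (fun x => F x ∈ ({2, 4, 8, 16, 32, 64} : Finset ℕ)) with F x = c,
          h (F x) = (Finset.univ.filter fun x => F x = c).card * h c := fun c hc => by
      rw [← nsmul_eq_mul, ← Finset.sum_const, Finset.filter_filter]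
      refine Finset.sum_congr ?_ fun x hx => by rw [(Finset.mem_filter.1 hx).2]
      ext x
      simp only [Finset.mem_filter, Finset.mem_univ, true_and, and_iff_right_iff_imp]
      rintro rfl
      exact hc
    rw [Finset.sum_congr rfl hfib]
    simp [c2, c4, c8, c16, c32, c64]
    ring
  have hc : (Finset.univ.filter fun x => F x ∈ ({2, 4, 8, 16, 32, 64} : Finset ℕ)).card =
      Fintype.card α := by
    have h1 := key fun _ => 1
    rw [Finset.sum_const, nsmul_one] at h1
    rw [hα, ← Nat.cast_inj (R := ℂ), h1]
    norm_num
  rw [← key g, Finset.eq_univ_of_card _ hc]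

theorem sum_comp_fixCount (g : ℕ → ℂ) : ∑ σ, g (fixCount σ) =
    8704 * g 2 + 17152 * g 4 + 11104 * g 8 + 2992 * g 16 + 352 * g 32 + 16 * g 64 :=
  sum_comp_of_sum_weight fixCount (by simp [Fintype.card_perm, Nat.factorial])
    sum_weight_fixCount g

theorem zmod_two_cases (x : ZMod 2) : x = 0 ∨ x = 1 := by
  revert x
  decide

/-- The matrix of the one-qubit projector `P_{1,4}`. -/
def qubitProj (u v : Fin 4 → ZMod 2) : ℂ :=
  4⁻¹ * ∑ a : ZMod 2 × ZMod 2, ∏ i, pauli a (u i) (v i)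

/-- The character `(-1)^x` of `ZMod 2`. -/
def sgn (x : ZMod 2) : ℂ := if x = 0 then 1 else -1

theorem prod_sgn (v : Fin 4 → ZMod 2) : ∏ i, sgn (v i) = sgn (∑ i, v i) := by
  have h : ∀ x y : ZMod 2, sgn x * sgn y = sgn (x + y) := by
    intro x y
    rcases zmod_two_cases x with rfl | rfl <;> rcases zmod_two_cases y with rfl | rfl <;> simp [sgn, CharTwo.add_self_eq_zero]
  simp [Fin.prod_univ_four, Fin.sum_univ_four, h]

theorem qubitProj_eq (u v : Fin 4 → ZMod 2) : qubitProj u v =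
    2⁻¹ * ∑ e : ZMod 2, if ∑ i, v i = 0 ∧ ∀ i, u i = v i + e then 1 else 0 := by
  have h00 : ∀ x y, pauli (0, 0) x y = if x = y + 0 then 1 else 0 := by simp [pauli]
  have h01 : ∀ x y, pauli (0, 1) x y = if x = y + 1 then 1 else 0 := by simp [pauli]
  have h10 : ∀ x y, pauli (1, 0) x y = if x = y + 0 then sgn y else 0 := by
    intro x y
    simp only [pauli, sgn, Matrix.of_apply]
    rcases zmod_two_cases x with rfl | rfl <;> rcases zmod_two_cases y with rfl | rfl <;> simp
  have h11 : ∀ x y, pauli (1, 1) x y = if x = y + 1 then Complex.I * sgn y else 0 := by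
    intro x y
    simp only [pauli, sgn, Matrix.of_apply]
    rcases zmod_two_cases x with rfl | rfl <;> rcases zmod_two_cases y with rfl | rfl <;> simp [CharTwo.add_self_eq_zero]
  have hu : ∀ f : ZMod 2 → ℂ, ∑ e, f e = f 0 + f 1 := fun f => Fin.sum_univ_two f
  have hs : 1 + sgn (∑ i, v i) = if ∑ i, v i = 0 then 2 else 0 := by
    unfold sgn
    split_ifs <;> norm_num
  have hI : ∏ i, Complex.I * sgn (v i) = sgn (∑ i, v i) := by
    rw [Finset.prod_mul_distrib, prod_sgn]
    simp [Complex.I_pow_four]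
  rw [qubitProj, Fintype.sum_prod_type, hu]
  simp only [hu, h00, h01, h10, h11, Finset.prod_ite_zero, prod_sgn, hI, Finset.prod_const_one,
    Finset.mem_univ, true_implies]
  have hp : ∀ e, (if ∑ i, v i = 0 ∧ ∀ i, u i = v i + e then (1 : ℂ) else 0) =
      2⁻¹ * (1 + sgn (∑ i, v i)) * if ∀ i, u i = v i + e then 1 else 0 := fun e => by
    rw [hs, ite_and]
    split_ifs <;> norm_num
  rw [hp, hp]
  split_ifs <;> ring

theorem stabProj_apply (n : ℕ) (x y : Fin 4 → Fin n → ZMod 2) :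
    stabProj n 4 x y = ∏ q, qubitProj (fun i => x i q) (fun i => y i q) := by
  simp only [stabProj, Matrix.smul_apply, Matrix.sum_apply, tpow, PauliW, Matrix.of_apply,
    smul_eq_mul, qubitProj, Finset.prod_mul_distrib, Finset.prod_univ_sum,
    Fintype.piFinset_univ, Finset.prod_const, Finset.card_univ, Fintype.card_fin]
  congr 1
  · rw [pow_mul, inv_pow]
    norm_num
  · exact Finset.sum_congr rfl fun a _ => Finset.prod_comm

/-- The matrix of the one-qubit operator `P_{1,4} ⊗ P_{1,4}`. -/
def qubitPair (u v : Fin 8 → ZMod 2) : ℂ :=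
  qubitProj ![u 0, u 1, u 2, u 3] ![v 0, v 1, v 2, v 3] *
    qubitProj ![u 4, u 5, u 6, u 7] ![v 4, v 5, v 6, v 7]

theorem stabProjPair_apply (n : ℕ) (x y : Fin 8 → Fin n → ZMod 2) :
    stabProjPair n x y = ∏ q, qubitPair (fun i => x i q) (fun i => y i q) := by
  simp only [stabProjPair, Matrix.of_apply, stabProj_apply, qubitPair,
    Finset.prod_mul_distrib]
  rfl

theorem trace_stabProjPair_mul_symProj (n : ℕ) :
    Matrix.trace (stabProjPair n * symProj (Fin n → ZMod 2) 8) =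
      (Nat.factorial 8 : ℂ)⁻¹ *
        ∑ σ : Equiv.Perm (Fin 8), (∑ z : Fin 8 → ZMod 2, qubitPair (fun i => z (σ i)) z) ^ n := by
  have hσ : ∀ σ : Equiv.Perm (Fin 8),
      ∑ y, stabProjPair n (fun k => y (σ k)) y =
        (∑ z : Fin 8 → ZMod 2, qubitPair (fun i => z (σ i)) z) ^ n := by
    intro σ
    have h := Finset.prod_univ_sum (fun _ : Fin n => Finset.univ)
      fun _ (z : Fin 8 → ZMod 2) => qubitPair (fun i => z (σ i)) z
    rw [Finset.prod_const, Finset.card_univ, Fintype.card_fin, Fintype.piFinset_univ] at h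
    rw [h, ← (Equiv.piComm fun (_ : Fin 8) (_ : Fin n) => ZMod 2).sum_comp]
    simp only [stabProjPair_apply]
    rfl
  simp only [← hσ, symProj, Matrix.mul_smul, Matrix.trace_smul, smul_eq_mul, Matrix.mul_sum,
    Matrix.trace_sum]
  congr 1
  refine Finset.sum_congr rfl fun σ _ => ?_
  simp only [Matrix.trace, Matrix.diag, Matrix.mul_apply, permOp, Matrix.of_apply]
  rw [Finset.sum_comm]
  simp

set_option maxRecDepth 4000 in
theorem card_fixed_pairs (σ : Equiv.Perm (Fin 8)) :
    (Finset.univ.filter fun x : (Fin 8 → ZMod 2) × (ZMod 2 × ZMod 2) =>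
      (x.1 0 + x.1 1 + x.1 2 + x.1 3 = 0 ∧ x.1 4 + x.1 5 + x.1 6 + x.1 7 = 0) ∧
        ∀ i, x.1 (σ i) = x.1 i +
          ![x.2.1, x.2.1, x.2.1, x.2.1, x.2.2, x.2.2, x.2.2, x.2.2] i).card = fixCount σ := by
  have hz : ∀ x : (Fin 8 → ZMod 2) × (ZMod 2 × ZMod 2),
      x.1 0 + x.1 1 + x.1 2 + x.1 3 = 0 ∧ x.1 4 + x.1 5 + x.1 6 + x.1 7 = 0 →
      evenWord ![x.1 0, x.1 1, x.1 2, x.2.1, x.1 4, x.1 5, x.1 6, x.2.2] = x.1 := by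
    rintro x ⟨h, h'⟩
    rw [CharTwo.add_eq_zero] at h h'
    ext i
    fin_cases i <;> first | rfl | exact h | exact h'
  rw [fixCount]
  refine Finset.card_bij'
    (fun x _ => ![x.1 0, x.1 1, x.1 2, x.2.1, x.1 4, x.1 5, x.1 6, x.2.2])
    (fun b _ => (evenWord b, (b 3, b 7))) ?_ ?_ ?_ ?_
  · intro x hx
    simp only [Finset.mem_filter_univ] at hx ⊢
    obtain ⟨h, hσ⟩ := hx
    rw [hz x h]
    exact hσ
  · intro b hb
    simp only [Finset.mem_filter_univ] at hb ⊢
    exact ⟨⟨CharTwo.add_self_eq_zero (b 0 + b 1 + b 2),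
      CharTwo.add_self_eq_zero (b 4 + b 5 + b 6)⟩, hb⟩
  · intro x hx
    simp only [Finset.mem_filter_univ] at hx
    exact Prod.ext (hz x hx.1) rfl
  · intro b _
    ext i
    fin_cases i <;> rfl

theorem sum_qubitPair (σ : Equiv.Perm (Fin 8)) :
    ∑ z : Fin 8 → ZMod 2, qubitPair (fun i => z (σ i)) z = fixCount σ / 4 := by
  have h : ∀ z : Fin 8 → ZMod 2, qubitPair (fun i => z (σ i)) z = 4⁻¹ * ∑ e : ZMod 2 × ZMod 2,
      if (z 0 + z 1 + z 2 + z 3 = 0 ∧ z 4 + z 5 + z 6 + z 7 = 0) ∧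
        ∀ i, z (σ i) = z i + ![e.1, e.1, e.1, e.1, e.2, e.2, e.2, e.2] i then 1 else 0 := by
    intro z
    rw [qubitPair, qubitProj_eq, qubitProj_eq, mul_mul_mul_comm, Finset.sum_mul_sum,
      Fintype.sum_prod_type]
    congr 1
    · norm_num
    · refine Finset.sum_congr rfl fun e _ => Finset.sum_congr rfl fun e' _ => ?_
      rw [ite_zero_mul_ite_zero, one_mul]
      refine if_congr ?_ rfl rfl
      simp [Fin.forall_fin_succ, Fin.sum_univ_four]
      tauto
  simp only [h, ← Finset.mul_sum]
  rw [← Fintype.sum_prod_type', Finset.sum_boole, card_fixed_pairs, div_eq_inv_mul]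

/-- With `d = 2^n`,
`tr((P_{n,4} ⊗ P_{n,4})·P_[8]) = C(d+7,8)·16(d²+15d+68)/(d²(d+3)(d+5)(d+6)(d+7))`. -/
theorem stmt13 (n : ℕ) (hn : 1 ≤ n) :
    Matrix.trace (stabProjPair n * symProj (Fin n → ZMod 2) 8)
      = ((2 ^ n + 7).choose 8 : ℂ) * 16 *
            (((2 : ℂ) ^ n) ^ 2 + 15 * (2 : ℂ) ^ n + 68) /
          ((((2 : ℂ) ^ n) ^ 2) * ((2 : ℂ) ^ n + 3) * ((2 : ℂ) ^ n + 5) *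
            ((2 : ℂ) ^ n + 6) * ((2 : ℂ) ^ n + 7)) := by
  have hchoose : ((2 ^ n + 7).choose 8 : ℂ) = (Nat.factorial 8 : ℂ)⁻¹ *
      ((2 : ℂ) ^ n * (2 ^ n + 1) * (2 ^ n + 2) * (2 ^ n + 3) * (2 ^ n + 4) * (2 ^ n + 5) *
        (2 ^ n + 6) * (2 ^ n + 7)) := by
    rw [Nat.choose_eq_descFactorial_div_factorial,
      Nat.cast_div (Nat.factorial_dvd_descFactorial _ _)
        (Nat.cast_ne_zero.2 (Nat.factorial_ne_zero 8)), div_eq_inv_mul]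
    congr 1
    simp only [Nat.descFactorial_succ, Nat.descFactorial_zero]
    simp only [Nat.reduceSubDiff]
    push_cast
    ring
  have hne : ∀ k : ℕ, (2 : ℂ) ^ n + k ≠ 0 := fun k => by
    have : ((2 ^ n + k : ℕ) : ℂ) ≠ 0 := Nat.cast_ne_zero.2 (by positivity)
    simpa using this
  have h0 : (2 : ℂ) ^ n ≠ 0 := by simp
  have h3 := hne 3
  have h5 := hne 5
  have h6 := hne 6
  have h7 := hne 7
  simp only [trace_stabProjPair_mul_symProj, sum_qubitPair, hchoose]
  rw [sum_comp_fixCount fun c => ((c : ℂ) / 4) ^ n]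
  have e2 : ((2 : ℕ) / 4 : ℂ) ^ n = (2 ^ n)⁻¹ := by rw [← inv_pow]; norm_num
  have e4 : ((4 : ℕ) / 4 : ℂ) ^ n = 1 := by norm_num
  have e8 : ((8 : ℕ) / 4 : ℂ) ^ n = 2 ^ n := by norm_num
  have e16 : ((16 : ℕ) / 4 : ℂ) ^ n = (2 ^ n) ^ 2 := by rw [pow_right_comm]; norm_num
  have e32 : ((32 : ℕ) / 4 : ℂ) ^ n = (2 ^ n) ^ 3 := by rw [pow_right_comm]; norm_num
  have e64 : ((64 : ℕ) / 4 : ℂ) ^ n = (2 ^ n) ^ 4 := by rw [pow_right_comm]; norm_num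
  rw [e2, e4, e8, e16, e32, e64]
  generalize (2 : ℂ) ^ n = d at *
  push_cast at h3 h5 h6 h7
  field_simp
  ring

end
end
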